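/- With the tensor-trick maps T^n i, T^n p, T^n h as above built from a special deformation retract, the side conditions propagate: T^n h ∘ T^n i = 0, T^n p ∘ T^n h = 0, and T^n h ∘ T^n h = 0, and moreover T^n p ∘ T^n i = identity on W^{⊗n}. -/

import Mathlib

open scoped TensorProduct

/-- A tensor product of linear maps vanishes as soon as one factor does. -/
theorem PiTensorProduct.map_eq_zero_of_factor {ι R : Type*} [CommSemiring R]
    {M N : ι → Type*} [∀ t, AddCommMonoid (M t)] [∀ t, Module R (M t)]
    [∀ t, AddCommMonoid (N t)] [∀ t, Module R (N t)]
    (f : ∀ t, M t →ₗ[R] N t) (j : ι) (hj : f j = 0) : PiTensorProduct.map f = 0 := by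
  ext x
  simpa using (PiTensorProduct.tprod R).map_coord_zero j (by simp [hj])

theorem LinearMap.sum_comp_eq {ι R M N P : Type*} [Semiring R]
    [AddCommMonoid M] [Module R M] [AddCommMonoid N] [Module R N] [AddCommMonoid P] [Module R P]
    (s : Finset ι) (f : ι → N →ₗ[R] P) (g : M →ₗ[R] N) :
    (∑ j ∈ s, f j) ∘ₗ g = ∑ j ∈ s, f j ∘ₗ g := by
  ext x
  simp [LinearMap.sum_apply]

theorem LinearMap.comp_sum_eq {ι R M N P : Type*} [Semiring R]
    [AddCommMonoid M] [Module R M] [AddCommMonoid N] [Module R N] [AddCommMonoid P] [Module R P]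
    (s : Finset ι) (g : N →ₗ[R] P) (f : ι → M →ₗ[R] N) :
    g ∘ₗ (∑ j ∈ s, f j) = ∑ j ∈ s, g ∘ₗ f j := by
  ext x
  simp [LinearMap.sum_apply]

/-- tensor trick, side conditions: with the tensor-trick maps
`Tⁿi = i^{⊗n}`, `Tⁿp = p^{⊗n}`, `Tⁿh = Σⱼ σ^{⊗j} ⊗ h ⊗ (i∘p)^{⊗(n-1-j)}`
(Koszul signs encoded by the parity operator `σ`) built from a special deformation
retract, the side conditions propagate:
`Tⁿh ∘ Tⁿi = 0`, `Tⁿp ∘ Tⁿh = 0`, `Tⁿh ∘ Tⁿh = 0`, and `Tⁿp ∘ Tⁿi = 1`. -/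
theorem stmt_7 (K V W : Type) [Field K]
    [AddCommGroup V] [Module K V] [AddCommGroup W] [Module K W]
    (n : ℕ) (dV σ h : V →ₗ[K] V) (dW : W →ₗ[K] W) (i : W →ₗ[K] V) (p : V →ₗ[K] W)
    (hdV : dV ∘ₗ dV = 0) (hdW : dW ∘ₗ dW = 0)
    (hchain_i : dV ∘ₗ i = i ∘ₗ dW) (hchain_p : dW ∘ₗ p = p ∘ₗ dV)
    (hpi : p ∘ₗ i = LinearMap.id)
    (hip : i ∘ₗ p - LinearMap.id = dV ∘ₗ h + h ∘ₗ dV)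
    (hhi : h ∘ₗ i = 0) (hph : p ∘ₗ h = 0) (hhh : h ∘ₗ h = 0)
    (hσσ : σ ∘ₗ σ = LinearMap.id)
    (hσd : σ ∘ₗ dV = -(dV ∘ₗ σ)) (hσh : σ ∘ₗ h = -(h ∘ₗ σ))
    (Th : (⨂[K] (_ : Fin n), V) →ₗ[K] ⨂[K] (_ : Fin n), V)
    (Ti : (⨂[K] (_ : Fin n), W) →ₗ[K] ⨂[K] (_ : Fin n), V)
    (Tp : (⨂[K] (_ : Fin n), V) →ₗ[K] ⨂[K] (_ : Fin n), W)
    (hTh : Th = ∑ j : Fin n, PiTensorProduct.map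
        (fun t : Fin n => if t < j then σ else if t = j then h else i ∘ₗ p))
    (hTi : Ti = PiTensorProduct.map (fun _ : Fin n => i))
    (hTp : Tp = PiTensorProduct.map (fun _ : Fin n => p)) :
    Th ∘ₗ Ti = 0 ∧ Tp ∘ₗ Th = 0 ∧ Th ∘ₗ Th = 0 ∧ Tp ∘ₗ Ti = LinearMap.id := by
  subst hTh hTi hTp
  refine ⟨?_, ?_, ?_, ?_⟩
  · rw [LinearMap.sum_comp_eq]
    refine Finset.sum_eq_zero fun j _ => ?_
    rw [← PiTensorProduct.map_comp]
    exact PiTensorProduct.map_eq_zero_of_factor _ j (by simp [hhi])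
  · rw [LinearMap.comp_sum_eq]
    refine Finset.sum_eq_zero fun j _ => ?_
    rw [← PiTensorProduct.map_comp]
    exact PiTensorProduct.map_eq_zero_of_factor _ j (by simp [hph])
  · rw [LinearMap.sum_comp_eq]
    refine Finset.sum_eq_zero fun j _ => ?_
    rw [LinearMap.comp_sum_eq]
    refine Finset.sum_eq_zero fun k _ => ?_
    rw [← PiTensorProduct.map_comp]
    rcases lt_trichotomy j k with hjk | rfl | hkj
    · exact PiTensorProduct.map_eq_zero_of_factor _ k
        (by simp [hjk.not_gt, hjk.ne', LinearMap.comp_assoc, hph])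
    · exact PiTensorProduct.map_eq_zero_of_factor _ j (by simp [hhh])
    · exact PiTensorProduct.map_eq_zero_of_factor _ j
        (by simp [hkj.not_gt, hkj.ne', ← LinearMap.comp_assoc, hhi])
  · rw [← PiTensorProduct.map_comp]
    simp only [hpi]
    exact PiTensorProduct.map_id
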